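/- arXiv:0806.3983 — 7 statements merged into one kernel-verified Lean document; each statement's English description precedes it below -/
import Mathlib

section
/- Let (L, η) be a localization on a category 𝒞. A morphism f : X ⟶ Y in 𝒞 is an L-equivalence if and only if for every L-local object Z the precomposition map Hom(Y, Z) ⟶ Hom(X, Z), g ↦ g ∘ f, is a bijection. -/
open CategoryTheory Category

/-- For a localization `(L, η)`, a morphism `f : X ⟶ Y` is an
`L`-equivalence iff precomposition with `f` is bijective on morphisms into every
`L`-local object. -/
theorem isLEquivalence_iff_precomp_bijective_on_local
    {C : Type*} [Category C] (L : C ⥤ C) (η : 𝟭 C ⟶ L)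
    (hη : ∀ X : C, η.app (L.obj X) = L.map (η.app X))
    (hiso : ∀ X : C, IsIso (L.map (η.app X)))
    {X Y : C} (f : X ⟶ Y) :
    IsIso (L.map f) ↔
      ∀ Z : C, (∃ W : C, Nonempty (Z ≅ L.obj W)) →
        Function.Bijective (fun g : Y ⟶ Z => f ≫ g) := by
  have nat : ∀ {A B : C} (g : A ⟶ B), g ≫ η.app B = η.app A ≫ L.map g :=
    fun g => η.naturality g
  constructor
  · rintro hf Z ⟨W, ⟨e⟩⟩
    have hZ : IsIso (η.app Z) := by
      have h1 : IsIso (η.app (L.obj W)) := by rw [hη]; exact hiso W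
      have h2 : η.app Z = e.hom ≫ η.app (L.obj W) ≫ L.map e.inv := by
        rw [← nat e.inv]
        exact (e.hom_inv_id_assoc _).symm
      rw [h2]
      exact IsIso.comp_isIso' inferInstance (IsIso.comp_isIso' h1 inferInstance)
    have hm : Mono (η.app Z) := inferInstance
    constructor
    · intro g g' h
      have h : f ≫ g = f ≫ g' := h
      have h3 : L.map f ≫ L.map g = L.map f ≫ L.map g' := by
        rw [← L.map_comp, ← L.map_comp, h]
      have h4 : L.map g = L.map g' := (cancel_epi _).1 h3
      have h5 : g ≫ η.app Z = g' ≫ η.app Z := by rw [nat, nat, h4]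
      exact hm.right_cancellation _ _ h5
    · intro h
      refine ⟨η.app Y ≫ inv (L.map f) ≫ L.map h ≫ inv (η.app Z), ?_⟩
      have h1 : f ≫ η.app Y ≫ inv (L.map f) ≫ L.map h ≫ inv (η.app Z)
          = (f ≫ η.app Y) ≫ inv (L.map f) ≫ L.map h ≫ inv (η.app Z) :=
        (Category.assoc _ _ _).symm
      have h2 : (η.app X ≫ L.map h) ≫ inv (η.app Z) = h := by
        rw [← nat h]
        exact (Category.assoc _ _ _).trans
          ((congrArg (h ≫ ·) (IsIso.hom_inv_id (η.app Z))).trans (Category.comp_id h))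
      refine h1.trans ?_
      rw [nat f, Category.assoc, IsIso.hom_inv_id_assoc, ← Category.assoc]
      exact h2
  · intro H
    obtain ⟨r, hr⟩ := (H (L.obj X) ⟨X, ⟨Iso.refl _⟩⟩).2 (η.app X)
    have hr : f ≫ r = η.app X := hr
    have h1 : r ≫ L.map f = η.app Y := by
      apply (H (L.obj Y) ⟨Y, ⟨Iso.refl _⟩⟩).1
      change f ≫ r ≫ L.map f = f ≫ η.app Y
      rw [nat f, ← hr, Category.assoc]
    have iX := hiso X
    have iY := hiso Y
    have h2 : L.map f ≫ L.map r = L.map (η.app X) := by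
      rw [← L.map_comp, hr]
    have h3 : L.map r ≫ L.map (L.map f) = L.map (η.app Y) := by
      rw [← L.map_comp, h1]
    have h4 : L.map f ≫ L.map (η.app Y) = L.map (η.app X) ≫ L.map (L.map f) := by
      rw [← hη, ← hη]; exact nat (L.map f)
    refine ⟨L.map r ≫ inv (L.map (η.app X)), ?_, ?_⟩
    · rw [← Category.assoc, h2]
      exact IsIso.hom_inv_id _
    · rw [← cancel_mono (L.map (η.app Y))]
      simp only [Category.assoc]
      rw [h4, IsIso.inv_hom_id_assoc, h3]
      exact (Category.id_comp _).symm
end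

section
/- Let (L, η) be a localization on a category 𝒞. An object Z of 𝒞 is L-local if and only if for every L-equivalence f : X ⟶ Y the precomposition map Hom(Y, Z) ⟶ Hom(X, Z), g ↦ g ∘ f, is a bijection. -/
open CategoryTheory Category

/-- For a localization `(L, η)`, an object `Z` is `L`-local iff
precomposition with every `L`-equivalence is bijective on morphisms into `Z`. -/
theorem isLocal_iff_precomp_bijective_on_equivalences
    {C : Type*} [Category C] (L : C ⥤ C) (η : 𝟭 C ⟶ L)
    (hη : ∀ X : C, η.app (L.obj X) = L.map (η.app X))
    (hiso : ∀ X : C, IsIso (L.map (η.app X)))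
    (Z : C) :
    (∃ W : C, Nonempty (Z ≅ L.obj W)) ↔
      ∀ (X Y : C) (f : X ⟶ Y), IsIso (L.map f) →
        Function.Bijective (fun g : Y ⟶ Z => f ≫ g) := by
  constructor
  · rintro ⟨W, ⟨e⟩⟩ X Y f hf
    have nat : ∀ {A B : C} (k : A ⟶ B), k ≫ η.app B = η.app A ≫ L.map k :=
      fun k => η.naturality k
    have hZ : IsIso (η.app Z) := by
      have h1 : IsIso (η.app (L.obj W)) := by rw [hη]; exact hiso W
      have h2 : η.app Z = e.hom ≫ η.app (L.obj W) ≫ L.map e.inv := by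
        rw [← nat e.inv, e.hom_inv_id_assoc]
      rw [h2]
      exact IsIso.comp_isIso' inferInstance (IsIso.comp_isIso' h1 inferInstance)
    constructor
    · intro g g' h
      have h3 : L.map f ≫ L.map g = L.map f ≫ L.map g' := by
        rw [← L.map_comp, ← L.map_comp]
        exact congrArg (fun k => L.map k) h
      have h4 : L.map g = L.map g' := (cancel_epi (L.map f)).1 h3
      have h5 : g ≫ η.app Z = g' ≫ η.app Z :=
        (nat g).trans ((congrArg (fun k => η.app Y ≫ k) h4).trans (nat g').symm)
      exact (cancel_mono (η.app Z)).1 h5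
    · intro h
      let g : Y ⟶ Z := η.app Y ≫ inv (L.map f) ≫ L.map h ≫ inv (η.app Z)
      refine ⟨g, ?_⟩
      refine (cancel_mono (η.app Z)).1 ?_
      have h6 : f ≫ η.app Y ≫ inv (L.map f) ≫ L.map h = η.app X ≫ L.map h := by
        rw [reassoc_of% (nat f), IsIso.hom_inv_id_assoc]
      have h7 : g ≫ η.app Z = η.app Y ≫ inv (L.map f) ≫ L.map h := by
        simp [g]
      change (f ≫ g) ≫ η.app Z = h ≫ η.app Z
      rw [Category.assoc]
      exact (congrArg (fun k => f ≫ k) h7).trans (h6.trans (nat h).symm)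
  · intro H
    obtain ⟨r, hr⟩ := (H Z (L.obj Z) (η.app Z) (hiso Z)).2 (𝟙 Z)
    have hr' : η.app Z ≫ r = 𝟙 Z := hr
    refine ⟨Z, ⟨⟨η.app Z, r, hr', ?_⟩⟩⟩
    have h1 : r ≫ η.app Z = η.app (L.obj Z) ≫ L.map r := η.naturality r
    have h2 : L.map (η.app Z) ≫ L.map r = 𝟙 (L.obj Z) :=
      (L.map_comp _ _).symm.trans ((congrArg (fun k => L.map k) hr').trans (L.map_id Z))
    rw [h1, hη]
    exact h2
end

section
/- Let (L, η) be a closed localization on a closed symmetric monoidal category 𝒞, let R be a monoid object in 𝒞, and let (M, a) be a left R-module with action a : R ⊗ M ⟶ M. Then there exists a unique left R-module structure a' : R ⊗ LM ⟶ LM on LM such that η_M : M ⟶ LM is a morphism of left R-modules, i.e. such that a' ∘ (id_R ⊗ η_M) = η_M ∘ a. -/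
open CategoryTheory Category MonoidalCategory

/-- A monoid object structure on an object `A`: a multiplication `m` and unit `u`
satisfying the unit and associativity axioms. -/
def MonoidAxioms {C : Type*} [Category C] [MonoidalCategory C]
    (A : C) (m : A ⊗ A ⟶ A) (u : 𝟙_ C ⟶ A) : Prop :=
  (u ▷ A) ≫ m = (λ_ A).hom ∧ (A ◁ u) ≫ m = (ρ_ A).hom ∧
    (m ▷ A) ≫ m = (α_ A A A).hom ≫ (A ◁ m) ≫ m

/-- A left module structure over a monoid object `(A, m, u)`: an action
`a : A ⊗ M ⟶ M` satisfying the unit and associativity axioms. -/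
def LeftModuleAxioms {C : Type*} [Category C] [MonoidalCategory C]
    {A : C} (m : A ⊗ A ⟶ A) (u : 𝟙_ C ⟶ A) (M : C) (a : A ⊗ M ⟶ M) : Prop :=
  (u ▷ M) ≫ a = (λ_ M).hom ∧
    (m ▷ M) ≫ a = (α_ A A M).hom ≫ (A ◁ a) ≫ a

theorem whisker_bij_aux {C : Type*} [Category C] [MonoidalCategory C] [SymmetricCategory C]
    [MonoidalClosed C] {X Y : C} (f : X ⟶ Y) (Z : C) (W : C)
    [IsIso ((MonoidalClosed.pre f).app Z)] :
    Function.Bijective (fun g : W ⊗ Y ⟶ Z => W ◁ f ≫ g) := by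
  constructor
  · intro g h hgh
    have hgh : W ◁ f ≫ g = W ◁ f ≫ h := hgh
    have key : f ▷ W ≫ (β_ Y W).hom ≫ g = f ▷ W ≫ (β_ Y W).hom ≫ h := by
      rw [BraidedCategory.braiding_naturality_left_assoc,
        BraidedCategory.braiding_naturality_left_assoc, hgh]
    have k2 := congrArg MonoidalClosed.curry key
    rw [← MonoidalClosed.curry_pre_app, ← MonoidalClosed.curry_pre_app, cancel_mono] at k2
    have k3 := MonoidalClosed.curry_injective k2
    rwa [cancel_epi] at k3
  · intro h
    refine ⟨(β_ Y W).inv ≫ MonoidalClosed.uncurry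
      (MonoidalClosed.curry ((β_ X W).hom ≫ h) ≫ inv ((MonoidalClosed.pre f).app Z)), ?_⟩
    have key : f ▷ W ≫ MonoidalClosed.uncurry
      (MonoidalClosed.curry ((β_ X W).hom ≫ h) ≫ inv ((MonoidalClosed.pre f).app Z))
        = (β_ X W).hom ≫ h := by
      apply MonoidalClosed.curry_injective
      rw [← MonoidalClosed.curry_pre_app, MonoidalClosed.curry_uncurry, assoc,
        IsIso.inv_hom_id, comp_id]
    change W ◁ f ≫ _ = h
    rw [← cancel_epi (β_ X W).hom,
      ← BraidedCategory.braiding_naturality_left_assoc, Iso.hom_inv_id_assoc, key]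

theorem module_aux {C : Type*} [Category C] [MonoidalCategory C] [SymmetricCategory C]
    [MonoidalClosed C] {R : C} (μ : R ⊗ R ⟶ R) (e : 𝟙_ C ⟶ R)
    {M N : C} (a : R ⊗ M ⟶ M) (hM : LeftModuleAxioms μ e M a) (h : M ⟶ N)
    [IsIso ((MonoidalClosed.pre h).app N)] :
    ∃! a' : R ⊗ N ⟶ N, LeftModuleAxioms μ e N a' ∧ (R ◁ h) ≫ a' = a ≫ h := by
  have bij := fun W : C => whisker_bij_aux (h) N W
  obtain ⟨a', ha'⟩ := (bij R).2 (a ≫ h)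
  have ha' : R ◁ h ≫ a' = a ≫ h := ha'
  obtain ⟨hu, hm⟩ := hM
  refine ⟨a', ⟨⟨?_, ?_⟩, ha'⟩, fun b hb => (bij R).1 (hb.2.trans ha'.symm)⟩
  · apply (bij (𝟙_ C)).1
    change 𝟙_ C ◁ h ≫ _ = 𝟙_ C ◁ h ≫ _
    rw [whisker_exchange_assoc, ha', reassoc_of% hu]
    exact (leftUnitor_naturality (h)).symm
  · apply (bij (R ⊗ R)).1
    change (R ⊗ R) ◁ h ≫ _ = (R ⊗ R) ◁ h ≫ _
    have h1 : R ◁ R ◁ h ≫ R ◁ a' = R ◁ a ≫ R ◁ h := by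
      rw [← whiskerLeft_comp, ha', whiskerLeft_comp]
    rw [whisker_exchange_assoc, ha', reassoc_of% hm, associator_naturality_right_assoc,
      reassoc_of% h1, ha']

/-- For a closed localization `(L, η)` on a closed symmetric monoidal
category, a monoid object `R`, and a left `R`-module `(M, a)`, there is a unique
left `R`-module structure on `LM` making `η_M` a morphism of left `R`-modules. -/
theorem closed_localization_preserves_left_modules
    {C : Type*} [Category C] [MonoidalCategory C] [SymmetricCategory C]
    [MonoidalClosed C]
    (L : C ⥤ C) (η : 𝟭 C ⟶ L)
    (hη : ∀ X : C, η.app (L.obj X) = L.map (η.app X))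
    (hiso : ∀ X : C, IsIso (L.map (η.app X)))
    (hclosed : ∀ ⦃X Y : C⦄ (f : X ⟶ Y), IsIso (L.map f) →
      ∀ Z : C, (∃ W : C, Nonempty (Z ≅ L.obj W)) →
        IsIso ((MonoidalClosed.pre f).app Z))
    (R : C) (μ : R ⊗ R ⟶ R) (e : 𝟙_ C ⟶ R) (hR : MonoidAxioms R μ e)
    (M : C) (a : R ⊗ M ⟶ M) (hM : LeftModuleAxioms μ e M a) :
    ∃! a' : R ⊗ L.obj M ⟶ L.obj M,
      LeftModuleAxioms μ e (L.obj M) a' ∧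
      (R ◁ η.app M) ≫ a' = a ≫ η.app M := by
  have hp : IsIso ((MonoidalClosed.pre (η.app M)).app (L.obj M)) :=
    hclosed (η.app M) (hiso M) _ ⟨M, ⟨Iso.refl _⟩⟩
  exact module_aux (M := M) μ e a hM (η.app M)
end

section
/- Let (L, η) be a closed localization on a closed symmetric monoidal category 𝒞, let R and S be monoid objects in 𝒞, and let M be an R-S-bimodule with left action l : R ⊗ M ⟶ M and right action r : M ⊗ S ⟶ M. Then there exists a unique R-S-bimodule structure (l', r') on LM such that η_M : M ⟶ LM is a morphism of R-S-bimodules, i.e. such that l' ∘ (id_R ⊗ η_M) = η_M ∘ l and r' ∘ (η_M ⊗ id_S) = η_M ∘ r. -/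
open CategoryTheory Category MonoidalCategory

/-- A right module structure over a monoid object `(A, m, u)`. -/
def RightModuleAxioms {C : Type*} [Category C] [MonoidalCategory C]
    {A : C} (m : A ⊗ A ⟶ A) (u : 𝟙_ C ⟶ A) (M : C) (r : M ⊗ A ⟶ M) : Prop :=
  (M ◁ u) ≫ r = (ρ_ M).hom ∧
    (r ▷ A) ≫ r = (α_ M A A).hom ≫ (M ◁ m) ≫ r

/-- An `R`-`S`-bimodule structure: a left `R`-action and a right `S`-action that
commute with each other. -/
def BimoduleAxioms {C : Type*} [Category C] [MonoidalCategory C]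
    {R S : C} (μR : R ⊗ R ⟶ R) (eR : 𝟙_ C ⟶ R)
    (μS : S ⊗ S ⟶ S) (eS : 𝟙_ C ⟶ S)
    (M : C) (l : R ⊗ M ⟶ M) (r : M ⊗ S ⟶ M) : Prop :=
  LeftModuleAxioms μR eR M l ∧ RightModuleAxioms μS eS M r ∧
    (l ▷ S) ≫ r = (α_ R M S).hom ≫ (R ◁ r) ≫ l

theorem pre_bij_aux {C : Type*} [Category C] [MonoidalCategory C] [MonoidalClosed C]
    {A B Z : C} (f : A ⟶ B) (h : IsIso ((MonoidalClosed.pre f).app Z)) (Y : C) :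
    Function.Bijective (fun g : B ⊗ Y ⟶ Z => (f ▷ Y) ≫ g) := by
  have key : ∀ g : B ⊗ Y ⟶ Z, MonoidalClosed.curry ((f ▷ Y) ≫ g) =
      MonoidalClosed.curry g ≫ (MonoidalClosed.pre f).app Z := by
    intro g
    simp [MonoidalClosed.curry_pre_app]
  constructor
  · intro a b hab
    have h2 := congrArg MonoidalClosed.curry hab
    simp only [key] at h2
    exact MonoidalClosed.curry_injective ((cancel_mono _).1 h2)
  · intro k
    refine ⟨MonoidalClosed.uncurry (MonoidalClosed.curry k ≫
      inv ((MonoidalClosed.pre f).app Z)), ?_⟩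
    apply MonoidalClosed.curry_injective
    simp only [key]
    simp

/-- For a closed localization `(L, η)`, monoid objects `R`, `S`, and an
`R`-`S`-bimodule `(M, l, r)`, there is a unique `R`-`S`-bimodule structure on `LM`
making `η_M` a morphism of `R`-`S`-bimodules. -/
theorem closed_localization_preserves_bimodules
    {C : Type*} [Category C] [MonoidalCategory C] [SymmetricCategory C]
    [MonoidalClosed C]
    (L : C ⥤ C) (η : 𝟭 C ⟶ L)
    (hη : ∀ X : C, η.app (L.obj X) = L.map (η.app X))
    (hiso : ∀ X : C, IsIso (L.map (η.app X)))
    (hclosed : ∀ ⦃X Y : C⦄ (f : X ⟶ Y), IsIso (L.map f) →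
      ∀ Z : C, (∃ W : C, Nonempty (Z ≅ L.obj W)) →
        IsIso ((MonoidalClosed.pre f).app Z))
    (R S : C) (μR : R ⊗ R ⟶ R) (eR : 𝟙_ C ⟶ R)
    (μS : S ⊗ S ⟶ S) (eS : 𝟙_ C ⟶ S)
    (hR : MonoidAxioms R μR eR) (hS : MonoidAxioms S μS eS)
    (M : C) (l : R ⊗ M ⟶ M) (r : M ⊗ S ⟶ M)
    (hM : BimoduleAxioms μR eR μS eS M l r) :
    ∃! q : (R ⊗ L.obj M ⟶ L.obj M) × (L.obj M ⊗ S ⟶ L.obj M),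
      BimoduleAxioms μR eR μS eS (L.obj M) q.1 q.2 ∧
      (R ◁ η.app M) ≫ q.1 = l ≫ η.app M ∧
      (η.app M ▷ S) ≫ q.2 = r ≫ η.app M := by
  have hc : IsIso ((MonoidalClosed.pre (η.app M)).app (L.obj M)) :=
    hclosed _ (hiso M) _ ⟨M, ⟨Iso.refl _⟩⟩
  have bij := pre_bij_aux (η.app M) hc
  have inj : ∀ {Y : C} {a b : L.obj M ⊗ Y ⟶ L.obj M},
      (η.app M ▷ Y) ≫ a = (η.app M ▷ Y) ≫ b → a = b := fun h => (bij _).1 h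
  have injL : ∀ {Y : C} {a b : Y ⊗ L.obj M ⟶ L.obj M},
      (Y ◁ η.app M) ≫ a = (Y ◁ η.app M) ≫ b → a = b := by
    intro Y a b h
    rw [← cancel_epi (β_ (L.obj M) Y).hom]
    apply inj
    have e : ∀ c : Y ⊗ L.obj M ⟶ L.obj M, (η.app M ▷ Y) ≫ (β_ (L.obj M) Y).hom ≫ c =
        (β_ _ Y).hom ≫ (Y ◁ η.app M) ≫ c := by
      intro c
      rw [BraidedCategory.braiding_naturality_left_assoc]
    rw [e, e, h]
  have injRR : ∀ {Y W : C} {a b : (L.obj M ⊗ Y) ⊗ W ⟶ L.obj M},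
      ((η.app M ▷ Y) ▷ W) ≫ a = ((η.app M ▷ Y) ▷ W) ≫ b → a = b := by
    intro Y W a b h
    rw [← cancel_epi (α_ (L.obj M) Y W).inv]
    apply inj
    rw [whiskerRight_tensor]
    simp only [assoc, Iso.hom_inv_id_assoc]
    rw [h]
  have injLL : ∀ {Y W : C} {a b : Y ⊗ (W ⊗ L.obj M) ⟶ L.obj M},
      (Y ◁ (W ◁ η.app M)) ≫ a = (Y ◁ (W ◁ η.app M)) ≫ b → a = b := by
    intro Y W a b h
    rw [← cancel_epi (α_ Y W (L.obj M)).hom]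
    apply injL
    rw [tensor_whiskerLeft]
    simp only [assoc, Iso.inv_hom_id_assoc]
    rw [h]
  have injM : ∀ {Y W : C} {a b : (Y ⊗ L.obj M) ⊗ W ⟶ L.obj M},
      ((Y ◁ η.app M) ▷ W) ≫ a = ((Y ◁ η.app M) ▷ W) ≫ b → a = b := by
    intro Y W a b h
    rw [← cancel_epi (β_ W (Y ⊗ L.obj M)).hom]
    apply injLL
    have e : ∀ c : (Y ⊗ L.obj M) ⊗ W ⟶ L.obj M,
        (W ◁ (Y ◁ η.app M)) ≫ (β_ W (Y ⊗ L.obj M)).hom ≫ c =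
        (β_ W _).hom ≫ ((Y ◁ η.app M) ▷ W) ≫ c := by
      intro c
      rw [BraidedCategory.braiding_naturality_right_assoc]
    rw [e, e, h]
  obtain ⟨⟨hl1, hl2⟩, ⟨hr1, hr2⟩, hlr⟩ := hM
  obtain ⟨r', hr'⟩ := (bij S).2 (r ≫ η.app M)
  obtain ⟨k, hk⟩ := (bij R).2 ((β_ _ _).hom ≫ l ≫ η.app M)
  obtain ⟨l', hl'⟩ : ∃ l' : R ⊗ L.obj M ⟶ L.obj M, (R ◁ η.app M) ≫ l' = l ≫ η.app M := by
    refine ⟨(β_ _ _).hom ≫ k, ?_⟩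
    rw [BraidedCategory.braiding_naturality_right_assoc]
    simp only at hk
    erw [hk]
    exact SymmetricCategory.symmetry_assoc _ _ _
  simp only at hr'
  simp only [Functor.id_obj] at hr' hl' inj injL injRR injLL injM
  refine ⟨(l', r'), ⟨⟨⟨?_, ?_⟩, ⟨?_, ?_⟩, ?_⟩, hl', hr'⟩, ?_⟩
  · apply injL
    rw [whisker_exchange_assoc, hl', reassoc_of% hl1]
    simp
  · apply injL
    simp only
    rw [whisker_exchange_assoc, hl', reassoc_of% hl2, tensor_whiskerLeft]
    simp only [assoc, Iso.inv_hom_id_assoc]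
    rw [← whiskerLeft_comp_assoc, hl', whiskerLeft_comp_assoc, hl']
  · apply inj
    rw [← whisker_exchange_assoc, hr', reassoc_of% hr1]
    simp
  · apply injRR
    simp only
    rw [← comp_whiskerRight_assoc, hr', comp_whiskerRight_assoc, hr', reassoc_of% hr2,
      associator_naturality_left_assoc, ← whisker_exchange_assoc, hr']
  · apply injM
    simp only
    rw [← comp_whiskerRight_assoc, hl', comp_whiskerRight_assoc, hr', reassoc_of% hlr,
      associator_naturality_middle_assoc, ← whiskerLeft_comp_assoc, hr',
      whiskerLeft_comp_assoc, hl']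
  · rintro ⟨l2, r2⟩ ⟨-, h1, h2⟩
    exact Prod.ext (injL (h1.trans hl'.symm)) (inj (h2.trans hr'.symm))
end

section
/- Let (L, η) be a closed localization on a closed symmetric monoidal category 𝒞, let R be a monoid object in 𝒞, and let f : M₁ ⟶ M₂ be a morphism of left R-modules. Equip LM₁ and LM₂ with left R-module structures such that η_{M₁} : M₁ ⟶ LM₁ and η_{M₂} : M₂ ⟶ LM₂ are morphisms of left R-modules. Then Lf : LM₁ ⟶ LM₂ is a morphism of left R-modules. -/
open CategoryTheory Category MonoidalCategory

/-- For a closed localization `(L, η)`, a monoid object `R`, and a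
morphism of left `R`-modules `f : M₁ ⟶ M₂`, if `LM₁` and `LM₂` carry left `R`-module
structures making `η_{M₁}` and `η_{M₂}` module morphisms, then `Lf` is a morphism of
left `R`-modules. -/
theorem closed_localization_preserves_module_morphisms
    {C : Type*} [Category C] [MonoidalCategory C] [SymmetricCategory C]
    [MonoidalClosed C]
    (L : C ⥤ C) (η : 𝟭 C ⟶ L)
    (hη : ∀ X : C, η.app (L.obj X) = L.map (η.app X))
    (hiso : ∀ X : C, IsIso (L.map (η.app X)))
    (hclosed : ∀ ⦃X Y : C⦄ (f : X ⟶ Y), IsIso (L.map f) →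
      ∀ Z : C, (∃ W : C, Nonempty (Z ≅ L.obj W)) →
        IsIso ((MonoidalClosed.pre f).app Z))
    (R : C) (μ : R ⊗ R ⟶ R) (e : 𝟙_ C ⟶ R) (hR : MonoidAxioms R μ e)
    (M₁ M₂ : C) (a₁ : R ⊗ M₁ ⟶ M₁) (a₂ : R ⊗ M₂ ⟶ M₂)
    (hM₁ : LeftModuleAxioms μ e M₁ a₁) (hM₂ : LeftModuleAxioms μ e M₂ a₂)
    (f : M₁ ⟶ M₂) (hf : a₁ ≫ f = (R ◁ f) ≫ a₂)
    (a₁' : R ⊗ L.obj M₁ ⟶ L.obj M₁) (a₂' : R ⊗ L.obj M₂ ⟶ L.obj M₂)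
    (hLM₁ : LeftModuleAxioms μ e (L.obj M₁) a₁')
    (hLM₂ : LeftModuleAxioms μ e (L.obj M₂) a₂')
    (hηa₁ : (R ◁ η.app M₁) ≫ a₁' = a₁ ≫ η.app M₁)
    (hηa₂ : (R ◁ η.app M₂) ≫ a₂' = a₂ ≫ η.app M₂) :
    a₁' ≫ L.map f = (R ◁ L.map f) ≫ a₂' := by
  have := hclosed (η.app M₁) (hiso M₁) (L.obj M₂) ⟨M₂, ⟨Iso.refl _⟩⟩
  have n : f ≫ η.app M₂ = η.app M₁ ≫ L.map f := η.naturality f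
  have key : (R ◁ η.app M₁) ≫ (a₁' ≫ L.map f) =
      (R ◁ η.app M₁) ≫ ((R ◁ L.map f) ≫ a₂') := by
    rw [← Category.assoc, hηa₁, Category.assoc]
    erw [← n]
    rw [← Category.assoc, hf, Category.assoc, ← hηa₂, ← Category.assoc, ← Category.assoc,
      ← MonoidalCategory.whiskerLeft_comp, n, MonoidalCategory.whiskerLeft_comp]
  rw [← cancel_epi (β_ (L.obj M₁) R).hom]
  apply MonoidalClosed.curry_injective
  rw [← cancel_mono ((MonoidalClosed.pre (η.app M₁)).app (L.obj M₂)),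
    MonoidalClosed.curry_pre_app, MonoidalClosed.curry_pre_app,
    BraidedCategory.braiding_naturality_left_assoc,
    BraidedCategory.braiding_naturality_left_assoc, key]
end

section
/- Every localization on the category Ab of abelian groups is closed: if (L, η) is a localization on Ab, f : X ⟶ Y is an L-equivalence, and Z is an L-local abelian group, then the induced morphism of internal homs Hom(Y, Z) ⟶ Hom(X, Z) (precomposition with f, as a homomorphism between the abelian groups of homomorphisms) is an isomorphism. -/
open CategoryTheory Category MonoidalCategory

/-- Every localization `(L, η)` on the category `Ab` of abelian groups
(realized as `ModuleCat ℤ`, with its closed symmetric monoidal structure given by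
`⊗_ℤ` and the internal hom of homomorphism groups) is closed: for every
`L`-equivalence `f : X ⟶ Y` and every `L`-local `Z`, the induced morphism of
internal homs `[f, Z] : [Y, Z] ⟶ [X, Z]` is an isomorphism. -/
theorem localization_on_ab_is_closed
    (L : ModuleCat ℤ ⥤ ModuleCat ℤ) (η : 𝟭 (ModuleCat ℤ) ⟶ L)
    (hη : ∀ X : ModuleCat ℤ, η.app (L.obj X) = L.map (η.app X))
    (hiso : ∀ X : ModuleCat ℤ, IsIso (L.map (η.app X)))
    {X Y : ModuleCat ℤ} (f : X ⟶ Y) (hf : IsIso (L.map f))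
    (Z : ModuleCat ℤ) (hZ : ∃ W : ModuleCat ℤ, Nonempty (Z ≅ L.obj W)) :
    IsIso ((MonoidalClosed.pre f).app Z) := by
  obtain ⟨W, ⟨e⟩⟩ := hZ
  have h1 : IsIso (η.app (L.obj W)) := by rw [hη]; exact hiso W
  have h2 : IsIso (η.app Z) := by
    have h := η.naturality e.hom
    have h3 : η.app Z = e.hom ≫ η.app (L.obj W) ≫ inv (L.map e.hom) := by
      simp only [Functor.id_map] at h
      rw [← assoc, h]; simp
    rw [h3]; infer_instance
  have key : ∀ (k : (ihom Y).obj Z) (x : X),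
      ((show X ⟶ Z from (MonoidalClosed.pre f).app Z k).hom x : Z)
        = (show Y ⟶ Z from k).hom (f.hom x) := by
    intro k x
    have h := MonoidalClosed.id_tensor_pre_app_comp_ev f Z
    have h' := congrArg (fun m => m.hom (x ⊗ₜ[ℤ] k)) h
    exact h'
  have key2 : ∀ (k : (ihom Y).obj Z),
      (show X ⟶ Z from (MonoidalClosed.pre f).app Z k) = f ≫ (show Y ⟶ Z from k) := by
    intro k
    ext x
    exact key k x
  rw [ConcreteCategory.isIso_iff_bijective]
  constructor
  · intro a b hab
    have h3 : f ≫ (show Y ⟶ Z from a) = f ≫ (show Y ⟶ Z from b) := by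
      rw [← key2, ← key2]; exact hab
    have h4 := congrArg L.map h3
    rw [L.map_comp, L.map_comp, cancel_epi] at h4
    have ha := η.naturality (show Y ⟶ Z from a)
    have hb := η.naturality (show Y ⟶ Z from b)
    rw [h4, ← hb, cancel_mono] at ha
    exact ha
  · intro g
    refine ⟨(η.app Y ≫ inv (L.map f) ≫ L.map (show X ⟶ Z from g) ≫ inv (η.app Z) : Y ⟶ Z), ?_⟩
    refine (key2 _).trans ?_
    have hn := η.naturality f
    have hg := η.naturality (show X ⟶ Z from g)
    simp only [Functor.id_map] at hn hg
    change f ≫ η.app Y ≫ inv (L.map f) ≫ L.map (show X ⟶ Z from g) ≫ inv (η.app Z) = (show X ⟶ Z from g)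
    rw [← assoc f, hn, assoc, IsIso.hom_inv_id_assoc, ← assoc, ← hg, assoc, IsIso.hom_inv_id, comp_id]
    rfl
end

section
/- Let (L, η) be a localization on the category Ab of abelian groups, let R and S be monoid objects in Ab (i.e. associative unital rings), and let M be an R-S-bimodule with left action l : R ⊗ M ⟶ M and right action r : M ⊗ S ⟶ M. Then there exists a unique R-S-bimodule structure (l', r') on LM such that η_M : M ⟶ LM is a morphism of R-S-bimodules, i.e. such that l' ∘ (id_R ⊗ η_M) = η_M ∘ l and r' ∘ (η_M ⊗ id_S) = η_M ∘ r. -/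
open CategoryTheory Category MonoidalCategory

/-- Precomposition with `g` is injective on maps to `Z`. -/
def EpiTo {K : Type} [CommRing K] (Z : ModuleCat.{0} K) {X Y : ModuleCat.{0} K} (g : X ⟶ Y) : Prop :=
  ∀ f f' : Y ⟶ Z, g ≫ f = g ≫ f' → f = f'

theorem EpiTo.left {K : Type} [CommRing K] {Z X Y : ModuleCat.{0} K} {g : X ⟶ Y} (h : EpiTo Z g) (A : ModuleCat.{0} K) :
    EpiTo Z (A ◁ g) := by
  intro f f' hf
  apply ModuleCat.hom_ext
  apply TensorProduct.ext
  apply LinearMap.ext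
  intro a
  have := h (ModuleCat.ofHom ((TensorProduct.mk K A Y a).comp LinearMap.id) ≫ f)
    (ModuleCat.ofHom ((TensorProduct.mk K A Y a).comp LinearMap.id) ≫ f') (by
      apply ModuleCat.hom_ext
      apply LinearMap.ext
      intro x
      exact LinearMap.congr_fun (congrArg ModuleCat.Hom.hom hf) (a ⊗ₜ[K] x : TensorProduct K A X))
  exact congrArg ModuleCat.Hom.hom this

theorem EpiTo.right {K : Type} [CommRing K] {Z X Y : ModuleCat.{0} K} {g : X ⟶ Y} (h : EpiTo Z g) (A : ModuleCat.{0} K) :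
    EpiTo Z (g ▷ A) := by
  intro f f' hf
  have := h.left A ((β_ A Y).hom ≫ f) ((β_ A Y).hom ≫ f') (by
    rw [BraidedCategory.braiding_naturality_right_assoc,
      BraidedCategory.braiding_naturality_right_assoc, hf])
  exact (cancel_epi _).1 this

theorem extend_left {K : Type} [CommRing K] {Z X Y : ModuleCat.{0} K} {g : X ⟶ Y} (h : EpiTo Z g)
    (hs : ∀ f : X ⟶ Z, ∃ f' : Y ⟶ Z, g ≫ f' = f) (A : ModuleCat.{0} K) (f : A ⊗ X ⟶ Z) :
    ∃ f' : A ⊗ Y ⟶ Z, (A ◁ g) ≫ f' = f := by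
  let φ : (Y →ₗ[K] Z) →ₗ[K] (X →ₗ[K] Z) := LinearMap.lcomp K Z g.hom
  have hφ : Function.Bijective φ := by
    constructor
    · intro a b hab
      exact congrArg ModuleCat.Hom.hom (h (ModuleCat.ofHom a) (ModuleCat.ofHom b)
        (ModuleCat.hom_ext hab))
    · intro b
      obtain ⟨c, hc⟩ := hs (ModuleCat.ofHom b)
      exact ⟨c.hom, congrArg ModuleCat.Hom.hom hc⟩
  let e := LinearEquiv.ofBijective φ hφ
  let c : A →ₗ[K] X →ₗ[K] Z := TensorProduct.curry f.hom
  refine ⟨ModuleCat.ofHom (TensorProduct.lift (e.symm.toLinearMap.comp c)), ?_⟩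
  apply ModuleCat.hom_ext
  apply TensorProduct.ext'
  intro a x
  exact LinearMap.congr_fun (e.apply_symm_apply (c a)) x

theorem extend_right {K : Type} [CommRing K] {Z X Y : ModuleCat.{0} K} {g : X ⟶ Y} (h : EpiTo Z g)
    (hs : ∀ f : X ⟶ Z, ∃ f' : Y ⟶ Z, g ≫ f' = f) (A : ModuleCat.{0} K) (f : X ⊗ A ⟶ Z) :
    ∃ f' : Y ⊗ A ⟶ Z, (g ▷ A) ≫ f' = f := by
  obtain ⟨k, hk⟩ := extend_left h hs A ((β_ A X).hom ≫ f)
  refine ⟨(β_ A Y).inv ≫ k, ?_⟩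
  rw [← cancel_epi (β_ A X).hom, ← hk, ← BraidedCategory.braiding_naturality_right_assoc,
    Iso.hom_inv_id_assoc]

theorem core {K : Type} [CommRing K] {M N : ModuleCat.{0} K} (h : M ⟶ N) (hE : EpiTo N h)
    (hs : ∀ f : M ⟶ N, ∃ f' : N ⟶ N, h ≫ f' = f)
    (R S : ModuleCat.{0} K) (μR : R ⊗ R ⟶ R) (eR : 𝟙_ (ModuleCat K) ⟶ R)
    (μS : S ⊗ S ⟶ S) (eS : 𝟙_ (ModuleCat K) ⟶ S)
    (l : R ⊗ M ⟶ M) (r : M ⊗ S ⟶ M)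
    (hM : BimoduleAxioms μR eR μS eS M l r) :
    ∃! q : (R ⊗ N ⟶ N) × (N ⊗ S ⟶ N),
      BimoduleAxioms μR eR μS eS N q.1 q.2 ∧
      (R ◁ h) ≫ q.1 = l ≫ h ∧ (h ▷ S) ≫ q.2 = r ≫ h := by
  obtain ⟨⟨hl1, hl2⟩, ⟨hr1, hr2⟩, hlr⟩ := hM
  obtain ⟨l', hl'⟩ := extend_left hE hs R (l ≫ h)
  obtain ⟨r', hr'⟩ := extend_right hE hs S (r ≫ h)
  refine ⟨(l', r'), ⟨⟨⟨?_, ?_⟩, ⟨?_, ?_⟩, ?_⟩, hl', hr'⟩, ?_⟩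
  · apply hE.left
    dsimp only
    rw [whisker_exchange_assoc, hl', reassoc_of% hl1, ← leftUnitor_naturality]
  · apply hE.left
    dsimp only
    rw [whisker_exchange_assoc, hl', reassoc_of% hl2, associator_naturality_right_assoc,
      ← whiskerLeft_comp_assoc, hl', whiskerLeft_comp_assoc, hl']
  · apply hE.right
    dsimp only
    rw [← whisker_exchange_assoc, hr', reassoc_of% hr1, ← rightUnitor_naturality]
  · apply (hE.right S).right
    dsimp only
    rw [← comp_whiskerRight_assoc, hr', comp_whiskerRight_assoc, hr', reassoc_of% hr2,
      associator_naturality_left_assoc, ← whisker_exchange_assoc, hr']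
  · apply (hE.left R).right
    dsimp only
    rw [← comp_whiskerRight_assoc, hl', comp_whiskerRight_assoc, hr', reassoc_of% hlr,
      associator_naturality_middle_assoc, ← whiskerLeft_comp_assoc, hr', whiskerLeft_comp_assoc,
      hl']
  · rintro ⟨l2, r2⟩ ⟨_, h1, h2⟩
    exact Prod.ext (hE.left R _ _ (h1.trans hl'.symm)) (hE.right S _ _ (h2.trans hr'.symm))

/-- For a localization `(L, η)` on the category `Ab` of abelian groups
(realized as `ModuleCat ℤ`), monoid objects `R`, `S` (i.e. rings), and an
`R`-`S`-bimodule `(M, l, r)`, there is a unique `R`-`S`-bimodule structure on `LM`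
making `η_M` a morphism of `R`-`S`-bimodules. -/
theorem localization_on_ab_preserves_bimodules
    (L : ModuleCat ℤ ⥤ ModuleCat ℤ) (η : 𝟭 (ModuleCat ℤ) ⟶ L)
    (hη : ∀ X : ModuleCat ℤ, η.app (L.obj X) = L.map (η.app X))
    (hiso : ∀ X : ModuleCat ℤ, IsIso (L.map (η.app X)))
    (R S : ModuleCat ℤ) (μR : R ⊗ R ⟶ R) (eR : 𝟙_ (ModuleCat ℤ) ⟶ R)
    (μS : S ⊗ S ⟶ S) (eS : 𝟙_ (ModuleCat ℤ) ⟶ S)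
    (hR : MonoidAxioms R μR eR) (hS : MonoidAxioms S μS eS)
    (M : ModuleCat ℤ) (l : R ⊗ M ⟶ M) (r : M ⊗ S ⟶ M)
    (hM : BimoduleAxioms μR eR μS eS M l r) :
    ∃! q : (R ⊗ L.obj M ⟶ L.obj M) × (L.obj M ⊗ S ⟶ L.obj M),
      BimoduleAxioms μR eR μS eS (L.obj M) q.1 q.2 ∧
      (R ◁ η.app M) ≫ q.1 = l ≫ η.app M ∧
      (η.app M ▷ S) ≫ q.2 = r ≫ η.app M := by
  have hi : ∀ X, IsIso (η.app (L.obj X)) := fun X => by rw [hη]; exact hiso X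
  have hnat : ∀ {X Y : ModuleCat ℤ} (f : X ⟶ Y), f ≫ η.app Y = η.app X ≫ L.map f :=
    fun f => η.naturality f
  have hE : EpiTo (L.obj M) (η.app M) := by
    intro f f' hf
    have h1 : L.map f = L.map f' := by
      have := hiso M
      rw [← cancel_epi (L.map (η.app M)), ← L.map_comp, ← L.map_comp, hf]
    have := hi M
    have hnat' : ∀ g : L.obj M ⟶ L.obj M, g ≫ η.app (L.obj M) = η.app (L.obj M) ≫ L.map g :=
      fun g => η.naturality g
    rw [← cancel_mono (η.app (L.obj M)), hnat', hnat', h1]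
  have hs : ∀ f : M ⟶ L.obj M, ∃ f' : L.obj M ⟶ L.obj M, η.app M ≫ f' = f := by
    intro f
    have := hi M
    refine ⟨L.map f ≫ inv (η.app (L.obj M)), ?_⟩
    rw [← assoc, ← hnat, assoc, IsIso.hom_inv_id, comp_id]
  exact core (η.app M) hE hs R S μR eR μS eS l r hM
end
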